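/- (Prime Number Theorem, Chebyshev form.) The Chebyshev prime counting function satisfies ψ(x) ∼ x as x → +∞, i.e. lim_{x→∞} ψ(x)/x = 1. -/

import Mathlib

open Filter Set ArithmeticFunction

/-- The Chebyshev prime counting function `ψ(x) = ∑_{n ≤ x} Λ(n)`, where `Λ`
is the von Mangoldt function. -/
noncomputable def chebyshevPsi (x : ℝ) : ℝ := ∑ n ∈ Finset.Iic ⌊x⌋₊, Λ n

open MeasureTheory Complex

/-- The Fejér kernel `(sin (v / 2) / (v / 2)) ^ 2`. -/
noncomputable def fejerKernel (v : ℝ) : ℝ := Real.sinc (v / 2) ^ 2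

lemma continuous_fejerKernel : Continuous fejerKernel := by
  unfold fejerKernel
  fun_prop

lemma fejerKernel_nonneg (v : ℝ) : 0 ≤ fejerKernel v := sq_nonneg _

lemma fejerKernel_le (v : ℝ) : fejerKernel v ≤ 5 * (1 + v ^ 2)⁻¹ := by
  rw [← div_eq_mul_inv, le_div_iff₀ (by positivity)]
  have h1 : fejerKernel v ≤ 1 := by
    rw [fejerKernel, sq_le_one_iff_abs_le_one]
    exact Real.abs_sinc_le_one _
  have h2 : fejerKernel v * v ^ 2 ≤ 4 := by
    rcases eq_or_ne v 0 with rfl | hv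
    · simp
    · rw [fejerKernel, Real.sinc_of_ne_zero (by positivity)]
      field_simp
      nlinarith [Real.sin_sq_le_one (v / 2)]
  linarith

lemma integrable_fejerKernel : Integrable fejerKernel :=
  (integrable_inv_one_add_sq.const_mul 5).mono' continuous_fejerKernel.aestronglyMeasurable
    (ae_of_all _ fun v => by
      rw [Real.norm_of_nonneg (fejerKernel_nonneg v)]
      exact fejerKernel_le v)

lemma integral_fejerKernel_pos : 0 < ∫ v, fejerKernel v := by
  rw [integral_pos_iff_support_of_nonneg fejerKernel_nonneg integrable_fejerKernel]
  exact (continuous_fejerKernel.isOpen_support).measure_pos volume ⟨0, by simp [fejerKernel]⟩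

lemma integral_triangle_mul_exp (v : ℝ) :
    ∫ u in (-1 : ℝ)..1, ((1 - |u| : ℝ) : ℂ) * cexp (I * (u * v)) = fejerKernel v := by
  have hc : Continuous fun u : ℝ => ((1 - |u| : ℝ) : ℂ) * cexp (I * (u * v)) := by fun_prop
  rw [← intervalIntegral.integral_add_adjacent_intervals (hc.intervalIntegrable (-1) 0)
    (hc.intervalIntegrable 0 1)]
  have h1 : ∫ u in (-1 : ℝ)..0, ((1 - |u| : ℝ) : ℂ) * cexp (I * (u * v)) =
      ∫ u in (-1 : ℝ)..0, (1 + (u : ℂ)) * cexp (I * (u * v)) := by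
    refine intervalIntegral.integral_congr fun u hu => ?_
    rw [uIcc_of_le (by norm_num)] at hu
    simp [abs_of_nonpos hu.2]
  have h2 : ∫ u in (0 : ℝ)..1, ((1 - |u| : ℝ) : ℂ) * cexp (I * (u * v)) =
      ∫ u in (0 : ℝ)..1, (1 - (u : ℂ)) * cexp (I * (u * v)) := by
    refine intervalIntegral.integral_congr fun u hu => ?_
    rw [uIcc_of_le (by norm_num)] at hu
    simp [abs_of_nonneg hu.1]
  rw [h1, h2]
  rcases eq_or_ne v 0 with rfl | hv
  · have e1 : ∫ u in (-1 : ℝ)..0, (1 + (u : ℂ)) = 1 / 2 := by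
      have : ∫ u in (-1 : ℝ)..0, (1 + u) = 1 / 2 := by
        rw [intervalIntegral.integral_add (by simp) (by simp)]; norm_num
      rw [← Complex.ofReal_one, ← Complex.ofReal_ofNat, ← Complex.ofReal_div, ← this,
        ← intervalIntegral.integral_ofReal]
      simp
    have e2 : ∫ u in (0 : ℝ)..1, (1 - (u : ℂ)) = 1 / 2 := by
      have : ∫ u in (0 : ℝ)..1, (1 - u) = 1 / 2 := by
        rw [intervalIntegral.integral_sub (by simp) (by simp)]; norm_num
      rw [← Complex.ofReal_one, ← Complex.ofReal_ofNat, ← Complex.ofReal_div, ← this,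
        ← intervalIntegral.integral_ofReal]
      simp
    simp [e1, e2, fejerKernel]
    norm_num
  have hv' : (v : ℂ) ≠ 0 := by exact_mod_cast hv
  have hI : I * v ≠ 0 := mul_ne_zero I_ne_zero hv'
  have hexp (u : ℝ) : HasDerivAt (fun u : ℝ => cexp (I * (u * v))) (cexp (I * (u * v)) * (I * v)) u := by
    have := (((hasDerivAt_id (u : ℂ)).mul_const (v : ℂ)).const_mul I).cexp.comp_ofReal
    simpa using this
  have hid (u : ℝ) : HasDerivAt (fun u : ℝ => (u : ℂ)) 1 u := (hasDerivAt_id (u : ℂ)).comp_ofReal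
  rw [intervalIntegral.integral_eq_sub_of_hasDerivAt (f := fun u : ℝ =>
      (1 + (u : ℂ)) * (cexp (I * (u * v)) / (I * v)) - cexp (I * (u * v)) / (I * v) ^ 2)
      (fun u _ => ?_) ((by fun_prop : Continuous _).intervalIntegrable _ _),
    intervalIntegral.integral_eq_sub_of_hasDerivAt (f := fun u : ℝ =>
      (1 - (u : ℂ)) * (cexp (I * (u * v)) / (I * v)) + cexp (I * (u * v)) / (I * v) ^ 2)
      (fun u _ => ?_) ((by fun_prop : Continuous _).intervalIntegrable _ _)]
  · rw [fejerKernel, Real.sinc_of_ne_zero (by positivity)]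
    push_cast
    have hs : Complex.sin (v / 2) ^ 2 = (2 - (cexp (I * v) + cexp (-(I * v)))) / 4 := by
      have := Complex.cos_sq' (v / 2 : ℂ)
      rw [Complex.cos_sq, mul_div_cancel₀ _ two_ne_zero, Complex.cos, mul_comm (v : ℂ) I, neg_mul,
        mul_comm (v : ℂ) I] at this
      linear_combination this
    rw [div_pow, hs]
    simp only [mul_pow, I_sq]
    field_simp
    simp
    ring_nf
  · refine ((((hid u).const_sub 1).mul ((hexp u).div_const (I * v))).add
      ((hexp u).div_const ((I * v) ^ 2))).congr_deriv ?_
    field_simp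
    ring
  · refine ((((hid u).const_add 1).mul ((hexp u).div_const (I * v))).sub
      ((hexp u).div_const ((I * v) ^ 2))).congr_deriv ?_
    field_simp
    ring

lemma integral_mul_exp_neg_mul_fejerKernel {h : ℝ → ℂ} (hm : Measurable h) {B : ℝ}
    (hB : ∀ t, ‖h t‖ ≤ B) {σ : ℝ} (hσ : 0 < σ) (l x : ℝ) :
    ∫ t in Ioi (0 : ℝ), h t * cexp (-(σ * t)) * fejerKernel (l * (x - t)) =
      ∫ u in (-1 : ℝ)..1, ((1 - |u| : ℝ) : ℂ) * cexp (I * (u * (l * x))) *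
        ∫ t in Ioi (0 : ℝ), h t * cexp (-((σ + I * (l * u)) * t)) := by
  have h1 : IntegrableOn (fun t : ℝ => h t * cexp (-(σ * t))) (Ioi 0) := by
    have := integrableOn_exp_mul_complex_Ioi (a := -(σ : ℂ)) (by simpa using hσ) 0
    refine Integrable.bdd_mul (c := B) ?_ hm.aestronglyMeasurable (ae_of_all _ hB)
    simpa [IntegrableOn] using this
  have h2 : IntegrableOn (fun u : ℝ => ((1 - |u| : ℝ) : ℂ)) (uIoc (-1) 1) :=
    ((by fun_prop : Continuous fun u : ℝ => ((1 - |u| : ℝ) : ℂ)).intervalIntegrable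
      (-1) 1).def'
  have h3 := (h2.mul_prod h1).bdd_mul (c := 1)
    (f := fun p : ℝ × ℝ => cexp (I * (p.1 * (l * (x - p.2)))))
    (by fun_prop : Continuous _).aestronglyMeasurable (ae_of_all _ fun p => by
      rw [Complex.norm_exp]; simp)
  have hswap := intervalIntegral_integral_swap (μ := volume.restrict (Ioi (0 : ℝ)))
    (f := fun u t : ℝ => cexp (I * (u * (l * (x - t)))) *
      (((1 - |u| : ℝ) : ℂ) * (h t * cexp (-(σ * t))))) h3
  calc
    _ = ∫ t in Ioi (0 : ℝ), ∫ u in (-1 : ℝ)..1, cexp (I * (u * (l * (x - t)))) *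
        (((1 - |u| : ℝ) : ℂ) * (h t * cexp (-(σ * t)))) := by
      congr 1 with t
      rw [← integral_triangle_mul_exp, ← intervalIntegral.integral_const_mul]
      congr 1 with u
      push_cast
      ring
    _ = _ := by
      rw [← hswap]
      congr 1 with u
      rw [← integral_const_mul]
      congr 1 with t
      have : cexp (I * (u * (l * (x - t)))) * cexp (-(σ * t)) =
          cexp (I * (u * (l * x))) * cexp (-((σ + I * (l * u)) * t)) := by
        rw [← Complex.exp_add, ← Complex.exp_add]
        ring_nf
      linear_combination ((1 - |u| : ℝ) : ℂ) * h t * this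

lemma integrable_fejerKernel_comp {l : ℝ} (hl : 0 < l) (x : ℝ) :
    Integrable fun t => fejerKernel (l * (x - t)) :=
  (integrable_fejerKernel.comp_mul_left' hl.ne').comp_sub_left x

lemma integral_mul_fejerKernel {h : ℝ → ℂ} (hm : Measurable h) {B : ℝ}
    (hB : ∀ t, ‖h t‖ ≤ B) {H : ℂ → ℂ} (hH : ContinuousOn H {z | 0 ≤ z.re})
    (hlap : ∀ z : ℂ, 0 < z.re → H z = ∫ t in Ioi (0 : ℝ), h t * cexp (-(z * t)))
    {l : ℝ} (hl : 0 < l) (x : ℝ) :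
    ∫ t in Ioi (0 : ℝ), h t * fejerKernel (l * (x - t)) =
      ∫ u in (-1 : ℝ)..1, ((1 - |u| : ℝ) : ℂ) * cexp (I * (u * (l * x))) * H (I * (l * u)) := by
  have hHc : Continuous fun p : ℝ × ℝ => H (((max p.1 0 : ℝ) : ℂ) + I * (l * p.2)) :=
    hH.comp_continuous (by fun_prop) (by simp)
  have hR : Tendsto (fun σ : ℝ => ∫ u in (-1 : ℝ)..1, ((1 - |u| : ℝ) : ℂ) *
      cexp (I * (u * (l * x))) * H (((max σ 0 : ℝ) : ℂ) + I * (l * u))) (nhdsWithin 0 (Ioi 0))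
      (nhds (∫ u in (-1 : ℝ)..1, ((1 - |u| : ℝ) : ℂ) *
        cexp (I * (u * (l * x))) * H (I * (l * u)))) := by
    have hc := intervalIntegral.continuous_parametric_intervalIntegral_of_continuous'
      (μ := volume) (f := fun σ u : ℝ => ((1 - |u| : ℝ) : ℂ) *
      cexp (I * (u * (l * x))) * H (((max σ 0 : ℝ) : ℂ) + I * (l * u)))
      (((by fun_prop : Continuous fun p : ℝ × ℝ => ((1 - |p.2| : ℝ) : ℂ) *
      cexp (I * (p.2 * (l * x))))).mul hHc) (-1) 1
    simpa using (hc.tendsto 0).mono_left nhdsWithin_le_nhds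
  have hL : Tendsto (fun σ : ℝ => ∫ t in Ioi (0 : ℝ), h t * cexp (-(σ * t)) *
      fejerKernel (l * (x - t))) (nhdsWithin 0 (Ioi 0))
      (nhds (∫ t in Ioi (0 : ℝ), h t * fejerKernel (l * (x - t)))) := by
    refine tendsto_integral_filter_of_dominated_convergence
      (fun t => B * fejerKernel (l * (x - t))) ?_ ?_
      ((integrable_fejerKernel_comp hl x).const_mul B).integrableOn ?_
    · refine Eventually.of_forall fun σ => ?_
      have := continuous_fejerKernel.measurable
      exact Measurable.aestronglyMeasurable (by fun_prop)
    · filter_upwards [self_mem_nhdsWithin] with σ hσ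
      filter_upwards [ae_restrict_mem measurableSet_Ioi] with t ht
      rw [norm_mul, norm_mul, Complex.norm_exp, Complex.norm_real,
        Real.norm_of_nonneg (fejerKernel_nonneg _)]
      refine mul_le_mul_of_nonneg_right ?_ (fejerKernel_nonneg _)
      refine (mul_le_of_le_one_right (norm_nonneg _) ?_).trans (hB t)
      rw [mem_Ioi] at hσ ht
      simpa using (mul_pos hσ ht).le
    · refine ae_of_all _ fun t => ?_
      have : Continuous fun σ : ℝ => h t * cexp (-(σ * t)) * fejerKernel (l * (x - t)) := by
        fun_prop
      simpa using (this.tendsto 0).mono_left nhdsWithin_le_nhds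
  refine tendsto_nhds_unique hL (hR.congr' ?_)
  filter_upwards [self_mem_nhdsWithin] with σ hσ
  rw [integral_mul_exp_neg_mul_fejerKernel hm hB hσ]
  congr 1 with u
  rw [max_eq_left (le_of_lt hσ), hlap _ (by simpa using hσ)]

lemma tendsto_integral_mul_fejerKernel {h : ℝ → ℂ} (hm : Measurable h) {B : ℝ}
    (hB : ∀ t, ‖h t‖ ≤ B) {H : ℂ → ℂ} (hH : ContinuousOn H {z | 0 ≤ z.re})
    (hlap : ∀ z : ℂ, 0 < z.re → H z = ∫ t in Ioi (0 : ℝ), h t * cexp (-(z * t)))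
    {l : ℝ} (hl : 0 < l) :
    Tendsto (fun x : ℝ => ∫ t in Ioi (0 : ℝ), h t * fejerKernel (l * (x - t))) atTop
      (nhds 0) := by
  have hRL := Real.tendsto_integral_exp_smul_cocompact
    ((Ioc (-1 : ℝ) 1).indicator fun u => ((1 - |u| : ℝ) : ℂ) * H (I * (l * u)))
  have hw : Tendsto (fun x : ℝ => -(l / (2 * Real.pi)) * x) atTop (cocompact ℝ) :=
    (tendsto_id.const_mul_atTop_of_neg (by simp; positivity)).mono_right atBot_le_cocompact
  refine (hRL.comp hw).congr fun x => ?_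
  rw [integral_mul_fejerKernel hm hB hH hlap hl, intervalIntegral.integral_of_le (by norm_num),
    ← integral_indicator measurableSet_Ioc]
  simp only [Function.comp_apply]
  congr 1 with u
  by_cases hu : u ∈ Ioc (-1 : ℝ) 1
  · simp only [indicator_of_mem hu, Circle.smul_def, Real.fourierChar_apply, smul_eq_mul]
    have : ((2 * Real.pi * -(u * (-(l / (2 * Real.pi)) * x)) : ℝ) : ℂ) * I =
        I * (u * (l * x)) := by
      push_cast
      have : (Real.pi : ℂ) ≠ 0 := by exact_mod_cast Real.pi_ne_zero
      field_simp
    rw [this]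
    ring
  · simp [indicator_of_notMem hu]

lemma integral_fejerKernel_comp_mul {l : ℝ} (hl : 0 < l) :
    ∫ s, fejerKernel (l * s) = (∫ v, fejerKernel v) / l := by
  rw [Measure.integral_comp_mul_left, abs_of_pos (inv_pos.2 hl), smul_eq_mul, inv_mul_eq_div]

lemma tendsto_mul_setIntegral_fejerKernel {δ : ℝ} (hδ : 0 < δ) :
    Tendsto (fun l : ℝ => l * ∫ s in Ioc (-δ) δ, fejerKernel (l * s)) atTop
      (nhds (∫ v, fejerKernel v)) := by
  have h := intervalIntegral_tendsto_integral (μ := volume) (f := fejerKernel)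
    (a := fun l : ℝ => l * -δ) (b := fun l : ℝ => l * δ) integrable_fejerKernel
    (tendsto_id.atTop_mul_const_of_neg (by linarith)) (tendsto_id.atTop_mul_const hδ)
  refine h.congr fun l => ?_
  rw [← intervalIntegral.integral_of_le (by linarith),
    intervalIntegral.mul_integral_comp_mul_left]

section Tauberian

variable {f : ℝ → ℝ}

lemma measurable_of_monotone_mul_exp (hmono : Monotone fun t => f t * Real.exp t) :
    Measurable f := by
  have : f = fun t => f t * Real.exp t * Real.exp (-t) := by
    ext t
    rw [mul_assoc, ← Real.exp_add]
    simp
  rw [this]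
  exact hmono.measurable.mul (by fun_prop)

lemma tendsto_integral_comp_sub_mul_fejerKernel (hmono : Monotone fun t => f t * Real.exp t)
    (hf0 : ∀ t, 0 ≤ f t) {B : ℝ} (hfB : ∀ t, f t ≤ B) (hneg : ∀ t ≤ 0, f t = 0)
    {H : ℂ → ℂ} (hH : ContinuousOn H {z | 0 ≤ z.re})
    (hlap : ∀ z : ℂ, 0 < z.re →
      H z = ∫ t in Ioi (0 : ℝ), ((f t : ℂ) - 1) * cexp (-(z * t)))
    {l : ℝ} (hl : 0 < l) :
    Tendsto (fun x : ℝ => ∫ s, f (x - s) * fejerKernel (l * s)) atTop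
      (nhds ((∫ v, fejerKernel v) / l)) := by
  have hfm := measurable_of_monotone_mul_exp hmono
  have hC := tendsto_integral_mul_fejerKernel (h := fun t => (f t : ℂ) - 1) (by fun_prop)
    (B := B + 1) (fun t => (norm_sub_le _ _).trans (by
      rw [Complex.norm_real, Real.norm_of_nonneg (hf0 t)]
      simpa using hfB t)) hH hlap hl
  have hR : Tendsto (fun x : ℝ => ∫ t in Ioi (0 : ℝ), (f t - 1) * fejerKernel (l * (x - t)))
      atTop (nhds 0) := by
    have := (Complex.continuous_re.tendsto _).comp hC
    rw [Complex.zero_re] at this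
    refine this.congr fun x => ?_
    rw [Function.comp_apply, ← Complex.ofReal_re (∫ t in Ioi (0 : ℝ), _),
      ← integral_complex_ofReal]
    push_cast
    rfl
  have hone : Tendsto (fun x : ℝ => ∫ t in Ioi (0 : ℝ), fejerKernel (l * (x - t))) atTop
      (nhds ((∫ v, fejerKernel v) / l)) := by
    rw [← integral_fejerKernel_comp_mul hl]
    have (x : ℝ) : ∫ t in Ioi (0 : ℝ), fejerKernel (l * (x - t)) =
        ∫ s, (Iio x).indicator (fun s => fejerKernel (l * s)) s := by
      rw [← integral_indicator measurableSet_Ioi, ← integral_sub_left_eq_self _ volume x]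
      congr 1 with s
      simp [indicator]
    simp_rw [this]
    refine tendsto_integral_filter_of_dominated_convergence (fun s => fejerKernel (l * s))
      (Eventually.of_forall fun x => ?_) (Eventually.of_forall fun x => ae_of_all _ fun s => ?_)
      (integrable_fejerKernel.comp_mul_left' hl.ne') (ae_of_all _ fun s => ?_)
    · exact ((integrable_fejerKernel.comp_mul_left' hl.ne').indicator
        measurableSet_Iio).aestronglyMeasurable
    · exact (norm_indicator_le_norm_self _ _).trans_eq
        (Real.norm_of_nonneg (fejerKernel_nonneg _))
    · refine tendsto_const_nhds.congr' ?_
      filter_upwards [eventually_gt_atTop s] with x hx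
      rw [indicator_of_mem (mem_Iio.2 hx)]
  have hsum := hR.add hone
  rw [zero_add] at hsum
  refine hsum.congr fun x => ?_
  have hK := (integrable_fejerKernel_comp hl x).integrableOn (s := Ioi 0)
  have hfK : IntegrableOn (fun t => (f t - 1) * fejerKernel (l * (x - t))) (Ioi 0) := by
    refine hK.bdd_mul (c := B + 1) (by fun_prop) (ae_of_all _ fun t => ?_)
    refine (norm_sub_le _ _).trans ?_
    rw [Real.norm_of_nonneg (hf0 t)]
    simpa using hfB t
  rw [← integral_add hfK hK, ← integral_sub_left_eq_self _ volume x,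
    ← integral_indicator measurableSet_Ioi]
  congr 1 with t
  by_cases ht : 0 < t
  · rw [indicator_of_mem (mem_Ioi.2 ht)]
    simp only [sub_sub_cancel]
    ring
  · rw [indicator_of_notMem (by simpa using ht)]
    simp [hneg t (not_lt.1 ht)]

/-- A Wiener–Ikehara type Tauberian theorem for bounded functions. -/
theorem tendsto_one_of_laplace (hmono : Monotone fun t => f t * Real.exp t)
    (hf0 : ∀ t, 0 ≤ f t) {B : ℝ} (hfB : ∀ t, f t ≤ B) (hneg : ∀ t ≤ 0, f t = 0)
    {H : ℂ → ℂ} (hH : ContinuousOn H {z | 0 ≤ z.re})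
    (hlap : ∀ z : ℂ, 0 < z.re →
      H z = ∫ t in Ioi (0 : ℝ), ((f t : ℂ) - 1) * cexp (-(z * t))) :
    Tendsto f atTop (nhds 1) := by
  have hfm := measurable_of_monotone_mul_exp hmono
  have hc := integral_fejerKernel_pos
  set c := ∫ v, fejerKernel v with hc_def
  have hlim {l : ℝ} (hl : 0 < l) :=
    tendsto_integral_comp_sub_mul_fejerKernel hmono hf0 hfB hneg hH hlap hl
  have hK {l : ℝ} (hl : 0 < l) : Integrable fun s => fejerKernel (l * s) :=
    integrable_fejerKernel.comp_mul_left' hl.ne'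
  have hfK {l : ℝ} (hl : 0 < l) (x : ℝ) : Integrable fun s => f (x - s) * fejerKernel (l * s) :=
    (hK hl).bdd_mul (c := B) (Measurable.aestronglyMeasurable (by fun_prop)) (ae_of_all _ fun s => by
      rw [Real.norm_of_nonneg (hf0 _)]; exact hfB _)
  have hstep {y z d : ℝ} (hyz : y ≤ z) (hd : z - y ≤ d) : f y ≤ f z * Real.exp d := by
    have h1 : f y ≤ f z * Real.exp (z - y) := by
      have := hmono hyz
      simp only at this
      rw [Real.exp_sub, ← mul_div_assoc, le_div_iff₀ (Real.exp_pos _)]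
      exact this
    exact h1.trans (mul_le_mul_of_nonneg_left (Real.exp_le_exp.2 hd) (hf0 z))
  have hexp : Tendsto (fun δ : ℝ => Real.exp (2 * δ)) (nhdsWithin 0 (Ioi 0)) (nhds 1) := by
    have : Continuous fun δ : ℝ => Real.exp (2 * δ) := by fun_prop
    simpa using (this.tendsto 0).mono_left nhdsWithin_le_nhds
  refine tendsto_order.2 ⟨fun a ha => ?_, fun a ha => ?_⟩
  · obtain ⟨δ, hδa, hδ⟩ : ∃ δ : ℝ, a * Real.exp (2 * δ) < 1 ∧ 0 < δ :=
      (((hexp.const_mul a).eventually_lt_const (by simpa using ha)).and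
        self_mem_nhdsWithin).exists
    obtain ⟨l, hlJ, hl⟩ : ∃ l : ℝ, a * Real.exp (2 * δ) *
        (l * ∫ s in Ioc (-δ) δ, fejerKernel (l * s)) <
        c - B * (c - l * ∫ s in Ioc (-δ) δ, fejerKernel (l * s)) ∧ 0 < l := by
      have hJ := tendsto_mul_setIntegral_fejerKernel hδ
      refine (((hJ.const_mul _).eventually_lt (((hJ.const_sub c).const_mul B).const_sub c)
        ?_).and (eventually_gt_atTop 0)).exists
      rw [← hc_def, sub_self, mul_zero, sub_zero]
      nlinarith
    set J := ∫ s in Ioc (-δ) δ, fejerKernel (l * s) with hJ_def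
    have hJ0 : 0 ≤ J := integral_nonneg fun s => fejerKernel_nonneg _
    have hbound (x : ℝ) : ∫ s, f (x - s) * fejerKernel (l * s) ≤
        f (x + δ) * Real.exp (2 * δ) * J + B * (c / l - J) := by
      rw [← integral_add_compl (measurableSet_Ioc (a := -δ) (b := δ)) (hfK hl x),
        hc_def, ← integral_fejerKernel_comp_mul hl,
        ← integral_add_compl (measurableSet_Ioc (a := -δ) (b := δ)) (hK hl), ← hJ_def,
        add_sub_cancel_left, hJ_def, ← integral_const_mul, ← integral_const_mul]
      refine add_le_add ?_ ?_
      · refine setIntegral_mono_on (hfK hl x).integrableOn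
          ((hK hl).const_mul _).integrableOn measurableSet_Ioc fun s hs => ?_
        exact mul_le_mul_of_nonneg_right
          (hstep (by linarith [hs.1]) (by linarith [hs.2])) (fejerKernel_nonneg _)
      · refine setIntegral_mono_on (hfK hl x).integrableOn
          ((hK hl).const_mul _).integrableOn measurableSet_Ioc.compl fun s hs => ?_
        exact mul_le_mul_of_nonneg_right (hfB _) (fejerKernel_nonneg _)
    have hlt : a * Real.exp (2 * δ) * J + B * (c / l - J) < c / l := by
      have h1 : (a * Real.exp (2 * δ) * J + B * (c / l - J)) * l < c := by
        have : c / l * l = c := by field_simp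
        linear_combination hlJ + B * this
      rwa [lt_div_iff₀ hl]
    have hev := (hlim hl).eventually_const_lt hlt
    filter_upwards [(tendsto_atTop_add_const_right atTop (-δ) tendsto_id).eventually hev] with x hx
    have h1 := hx.trans_le (hbound _)
    simp only [id, neg_add_cancel_right] at h1
    have h2 : 0 < (f x - a) * (Real.exp (2 * δ) * J) := by linarith
    have h3 : 0 ≤ Real.exp (2 * δ) * J := by positivity
    linarith [pos_of_mul_pos_left h2 h3]
  · obtain ⟨δ, hδa, hδ⟩ : ∃ δ : ℝ, Real.exp (2 * δ) < a ∧ 0 < δ :=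
      ((hexp.eventually_lt_const ha).and self_mem_nhdsWithin).exists
    obtain ⟨l, hlJ, hl⟩ : ∃ l : ℝ, Real.exp (2 * δ) * c <
        a * (l * ∫ s in Ioc (-δ) δ, fejerKernel (l * s)) ∧ 0 < l :=
      ((((tendsto_mul_setIntegral_fejerKernel hδ).const_mul a).eventually_const_lt
        (mul_lt_mul_of_pos_right hδa hc)).and (eventually_gt_atTop 0)).exists
    set J := ∫ s in Ioc (-δ) δ, fejerKernel (l * s) with hJ_def
    have hJ0 : 0 ≤ J := integral_nonneg fun s => fejerKernel_nonneg _
    have hbound (x : ℝ) : f (x - δ) * J ≤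
        Real.exp (2 * δ) * ∫ s, f (x - s) * fejerKernel (l * s) := by
      refine le_trans ?_ (mul_le_mul_of_nonneg_left (setIntegral_le_integral (s := Ioc (-δ) δ)
        (hfK hl x) (ae_of_all _ fun s => mul_nonneg (hf0 _) (fejerKernel_nonneg _)))
        (Real.exp_pos _).le)
      rw [hJ_def, ← integral_const_mul, ← integral_const_mul]
      refine setIntegral_mono_on ((hK hl).const_mul _).integrableOn
        ((hfK hl x).const_mul _).integrableOn measurableSet_Ioc fun s hs => ?_
      rw [← mul_assoc, mul_comm (Real.exp _)]
      exact mul_le_mul_of_nonneg_right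
        (hstep (by linarith [hs.2]) (by linarith [hs.1])) (fejerKernel_nonneg _)
    have hlt : Real.exp (2 * δ) * (c / l) < a * J := by
      rw [← mul_div_assoc, div_lt_iff₀ hl]
      linarith
    have hev := ((hlim hl).const_mul (Real.exp (2 * δ))).eventually_lt_const hlt
    filter_upwards [(tendsto_atTop_add_const_right atTop δ tendsto_id).eventually hev] with x hx
    have h1 := (hbound _).trans_lt hx
    simp only [id, add_sub_cancel_right] at h1
    exact lt_of_mul_lt_mul_right h1 hJ0

end Tauberian

/-- `L(Λ, s) - 1 / (s - 1)` extends continuously to `1 ≤ re s`. -/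
lemma exists_continuousOn_LSeries_vonMangoldt_sub :
    ∃ G : ℂ → ℂ, ContinuousOn G {s | 1 ≤ s.re} ∧
      ∀ s : ℂ, 1 < s.re → G s = LSeries (fun n => (Λ n : ℂ)) s - 1 / (s - 1) := by
  refine ⟨_, vonMangoldt.continuousOn_LFunctionResidueClassAux (q := 1) 1, fun s hs => ?_⟩
  rw [vonMangoldt.eqOn_LFunctionResidueClassAux isUnit_one hs]
  have : vonMangoldt.residueClass (1 : ZMod 1) = fun n => Λ n := by
    ext n
    have hn : n ∈ {n : ℕ | (n : ZMod 1) = 1} := Subsingleton.elim (n : ZMod 1) 1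
    rw [vonMangoldt.residueClass, indicator_of_mem hn]
  simp [this]

lemma chebyshevPsi_eq_psi (x : ℝ) : chebyshevPsi x = Chebyshev.psi x := by
  rw [Chebyshev.psi_eq_sum_Icc]
  rfl

lemma LSeries_vonMangoldt_eq_mul_integral_psi {s : ℂ} (hs : 1 < s.re) :
    LSeries (fun n => (Λ n : ℂ)) s = s * ∫ t in Ioi (0 : ℝ),
      ((Chebyshev.psi (Real.exp t) / Real.exp t : ℝ) : ℂ) * cexp (-((s - 1) * t)) := by
  have hO : (fun n : ℕ => ∑ k ∈ Finset.Icc 1 n, Λ k) =O[atTop] fun n => (n : ℝ) ^ (1 : ℝ) := by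
    refine Asymptotics.IsBigO.of_bound (Real.log 4 + 4) (Eventually.of_forall fun n => ?_)
    have h := Chebyshev.psi_le_const_mul_self (Nat.cast_nonneg (α := ℝ) n)
    rw [Chebyshev.psi, Nat.floor_natCast] at h
    rw [Real.norm_of_nonneg (Finset.sum_nonneg fun _ _ => vonMangoldt_nonneg), Real.rpow_one,
      Real.norm_of_nonneg (Nat.cast_nonneg n)]
    exact h
  rw [LSeries_eq_mul_integral_of_nonneg _ zero_le_one hs hO fun _ => vonMangoldt_nonneg]
  have := integral_comp_exp_Ioi (fun t : ℝ =>
    (∑ k ∈ Finset.Icc 1 ⌊t⌋₊, (Λ k : ℂ)) * (t : ℂ) ^ (-(s + 1))) 0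
  rw [Real.exp_zero] at this
  rw [← this]
  congr 2 with t
  have hψ : ∑ k ∈ Finset.Icc 1 ⌊Real.exp t⌋₊, (Λ k : ℂ) = (Chebyshev.psi (Real.exp t) : ℂ) := by
    rw [Chebyshev.psi]
    push_cast
    rfl
  rw [hψ, Complex.real_smul, Complex.cpow_def_of_ne_zero (by simp [Complex.exp_ne_zero]),
    ← Complex.ofReal_log (Real.exp_pos t).le, Real.log_exp]
  push_cast
  have : cexp (t * -(s + 1)) * cexp t * cexp t = cexp (-((s - 1) * t)) := by
    rw [← Complex.exp_add, ← Complex.exp_add]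
    ring_nf
  rw [← this]
  field_simp

/-- The Prime Number Theorem in Chebyshev's form: `ψ(x) ∼ x` as `x → ∞`. -/
theorem prime_number_theorem_psi :
    Tendsto (fun x : ℝ => chebyshevPsi x / x) atTop (nhds 1) := by
  obtain ⟨G, hG, hGL⟩ := exists_continuousOn_LSeries_vonMangoldt_sub
  have hB (t : ℝ) : Chebyshev.psi (Real.exp t) / Real.exp t ≤ Real.log 4 + 4 :=
    (div_le_iff₀ (Real.exp_pos t)).2 (Chebyshev.psi_le_const_mul_self (Real.exp_pos t).le)
  have h0 (t : ℝ) : 0 ≤ Chebyshev.psi (Real.exp t) / Real.exp t :=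
    div_nonneg (Chebyshev.psi_nonneg _) (Real.exp_pos t).le
  have hmono : Monotone fun t =>
      Chebyshev.psi (Real.exp t) / Real.exp t * Real.exp t := by
    simp_rw [div_mul_cancel₀ _ (Real.exp_ne_zero _)]
    exact Chebyshev.psi_mono.comp Real.exp_monotone
  have key : Tendsto (fun t => Chebyshev.psi (Real.exp t) / Real.exp t) atTop (nhds 1) := by
    refine tendsto_one_of_laplace hmono h0 hB (fun t ht => ?_)
      (H := fun z => (G (1 + z) - 1) / (1 + z)) ?_ fun z hz => ?_
    · rw [Chebyshev.psi_eq_zero_of_le_one (Real.exp_le_one_iff.2 ht), zero_div]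
    · refine ((hG.comp (by fun_prop) fun z hz => ?_).sub continuousOn_const).div
        (by fun_prop) fun z hz h => ?_
      · simpa using hz
      · have := congrArg Complex.re h
        simp only [Complex.add_re, Complex.one_re, Complex.zero_re] at this
        linarith [show 0 ≤ z.re from hz]
    · have hz0 : z ≠ 0 := fun h => by simp [h] at hz
      have hz1 : 1 + z ≠ 0 := fun h => by
        have := congrArg Complex.re h
        simp only [Complex.add_re, Complex.one_re, Complex.zero_re] at this
        linarith
      have hint : IntegrableOn (fun t : ℝ => cexp (-(z * t))) (Ioi 0) := by
        simpa using integrableOn_exp_mul_complex_Ioi (a := -z) (by simpa using hz) 0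
      have hone : ∫ t in Ioi (0 : ℝ), cexp (-(z * t)) = 1 / z := by
        simpa using integral_exp_mul_complex_Ioi (a := -z) (by simpa using hz) 0
      have hfint : IntegrableOn (fun t : ℝ =>
          ((Chebyshev.psi (Real.exp t) / Real.exp t : ℝ) : ℂ) * cexp (-(z * t))) (Ioi 0) := by
        have hm := measurable_of_monotone_mul_exp hmono
        refine hint.bdd_mul (c := Real.log 4 + 4)
          (Complex.measurable_ofReal.comp hm).aestronglyMeasurable (ae_of_all _ fun t => ?_)
        rw [Complex.norm_real, Real.norm_of_nonneg (h0 t)]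
        exact hB t
      simp_rw [sub_mul, one_mul]
      rw [integral_sub hfint hint, hone, hGL _ (by simpa using hz),
        LSeries_vonMangoldt_eq_mul_integral_psi (by simpa using hz)]
      simp only [add_sub_cancel_left]
      field_simp
      ring
  refine (key.comp Real.tendsto_log_atTop).congr' ?_
  filter_upwards [eventually_gt_atTop 0] with x hx
  rw [Function.comp_apply, Real.exp_log hx, chebyshevPsi_eq_psi]
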